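/- Let X and Y be real normed vector spaces, let K > 0, and let f : X → Y be Lipschitz continuous with constant C_K on the closed ball of radius K in X, i.e. ‖f(u) − f(v)‖ ≤ C_K‖u − v‖ whenever ‖u‖ ≤ K and ‖v‖ ≤ K. Define the truncation f_K : X → Y by f_K(u) = f(u) if ‖u‖ ≤ K and f_K(u) = f(Ku/‖u‖) if ‖u‖ > K. Then f_K is globally Lipschitz continuous on X with Lipschitz constant at most 2C_K, i.e. ‖f_K(u) − f_K(v)‖ ≤ 2C_K‖u − v‖ for all u, v ∈ X. -/

import Mathlib

theorem trunc_scalar_aux (K a b : ℝ) (hK : 0 < K) (ha : 0 ≤ a) (hb : 0 ≤ b) :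
    |(if a ≤ K then 1 else K / a) - (if b ≤ K then 1 else K / b)| * b ≤ |a - b| := by
  split_ifs with h1 h2 h2
  · simp
  · push Not at h2
    have hb0 : 0 < b := hK.trans h2
    have : K / b ≤ 1 := by rw [div_le_one hb0]; exact h2.le
    rw [abs_of_nonneg (by linarith), sub_mul, div_mul_cancel₀ _ hb0.ne', abs_sub_comm]
    exact le_trans (by linarith) (le_abs_self _)
  · push Not at h1
    have ha0 : 0 < a := hK.trans h1
    have h3 : K / a ≤ 1 := by rw [div_le_one ha0]; exact h1.le
    rw [abs_sub_comm, abs_of_nonneg (by linarith)]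
    have h4 : (1 - K / a) * b ≤ (1 - K / a) * a :=
      mul_le_mul_of_nonneg_left (by linarith) (by linarith)
    rw [sub_mul _ _ a, div_mul_cancel₀ _ ha0.ne'] at h4
    exact le_trans (by linarith) (le_abs_self _)
  · push Not at h1 h2
    have ha0 : 0 < a := hK.trans h1
    have hb0 : 0 < b := hK.trans h2
    have h3 : K / a ≤ 1 := by rw [div_le_one ha0]; exact h1.le
    have h5 : K / a - K / b = (K / a) * (b - a) / b := by field_simp
    rw [h5, abs_div, abs_of_pos hb0, div_mul_cancel₀ _ hb0.ne', abs_mul,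
      abs_of_pos (div_pos hK ha0), abs_sub_comm]
    exact mul_le_of_le_one_left (abs_nonneg _) h3

/-- Truncation lemma: if `f` is Lipschitz with constant `C_K` on the closed ball of
radius `K`, then the radial truncation `f_K` is globally Lipschitz with constant `2 * C_K`. -/
theorem truncation_globally_lipschitz
    {X Y : Type*} [NormedAddCommGroup X] [NormedSpace ℝ X]
    [NormedAddCommGroup Y] [NormedSpace ℝ Y]
    (K : ℝ) (hK : 0 < K) (C_K : ℝ)
    (f : X → Y)
    (hf : ∀ u v : X, ‖u‖ ≤ K → ‖v‖ ≤ K → ‖f u - f v‖ ≤ C_K * ‖u - v‖)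
    (fK : X → Y)
    (hfK : ∀ u : X, fK u = if ‖u‖ ≤ K then f u else f ((K / ‖u‖) • u)) :
    ∀ u v : X, ‖fK u - fK v‖ ≤ 2 * C_K * ‖u - v‖ := by
  intro u v
  by_cases huv : u = v
  · simp [huv]
  have hd : 0 < ‖u - v‖ := norm_pos_iff.mpr (sub_ne_zero.mpr huv)
  have hC : 0 ≤ C_K := by
    have hw : ‖(K / ‖u - v‖) • (u - v)‖ = K := by
      rw [norm_smul, Real.norm_of_nonneg (by positivity), div_mul_cancel₀ _ hd.ne']
    have h := hf ((K / ‖u - v‖) • (u - v)) 0 hw.le (by simpa using hK.le)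
    rw [sub_zero, hw] at h
    exact nonneg_of_mul_nonneg_left ((norm_nonneg _).trans h) hK
  let r : X → ℝ := fun x => if ‖x‖ ≤ K then 1 else K / ‖x‖
  have hP : ∀ x, fK x = f (r x • x) := by
    intro x
    rw [hfK]
    by_cases h : ‖x‖ ≤ K <;> simp [r, h]
  have hr0 : ∀ x, 0 ≤ r x := by
    intro x
    simp only [r]
    split_ifs <;> positivity
  have hr1 : ∀ x, r x ≤ 1 := by
    intro x
    simp only [r]
    split_ifs with h
    · exact le_rfl
    · push Not at h
      rw [div_le_one (hK.trans h)]
      exact h.le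
  have hrK : ∀ x, ‖r x • x‖ ≤ K := by
    intro x
    rw [norm_smul, Real.norm_of_nonneg (hr0 x)]
    simp only [r]
    split_ifs with h
    · simpa using h
    · push Not at h
      rw [div_mul_cancel₀ _ (hK.trans h).ne']
  have key : ‖r u • u - r v • v‖ ≤ 2 * ‖u - v‖ := by
    have e : r u • u - r v • v = r u • (u - v) + (r u - r v) • v := by module
    have h1 : ‖r u • (u - v)‖ ≤ ‖u - v‖ := by
      rw [norm_smul, Real.norm_of_nonneg (hr0 u)]
      exact mul_le_of_le_one_left (norm_nonneg _) (hr1 u)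
    have h2 : ‖(r u - r v) • v‖ ≤ ‖u - v‖ := by
      rw [norm_smul, Real.norm_eq_abs]
      exact (trunc_scalar_aux K ‖u‖ ‖v‖ hK (norm_nonneg _) (norm_nonneg _)).trans
        (abs_norm_sub_norm_le u v)
    rw [e]
    exact (norm_add_le _ _).trans (by linarith)
  rw [hP, hP]
  calc _ ≤ C_K * ‖r u • u - r v • v‖ := hf _ _ (hrK u) (hrK v)
    _ ≤ C_K * (2 * ‖u - v‖) := mul_le_mul_of_nonneg_left key hC
    _ = _ := by ring
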